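/- arXiv:2412.07058 — 2 statements merged into one kernel-verified Lean document; each statement's English description precedes it below -/
import Mathlib

section
/- There exist a constant c > 0 and N such that for every perfect square n ≥ N, the uniform average over A in S_n (the n × n symmetric 𝔽₂ matrices with zero diagonal) of the maximal rank deficiency of principal submatrices satisfies E_A[ max_{S ⊆ {1,…,n}} ( |S| − rank(A[S]) ) ] ≥ c · n^{1/4} / log n. -/
open scoped BigOperators

noncomputable section

/-- The set `S_n` of `n × n` symmetric matrices over `𝔽₂` with zero diagonal
(adjacency matrices). -/
def symZeroDiag (n : ℕ) : Finset (Matrix (Fin n) (Fin n) (ZMod 2)) :=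
  Finset.univ.filter fun A => A.IsSymm ∧ ∀ i, A i i = 0

open Classical in
/-- The probability of the event `p` under the uniform distribution on `S_n` (the
fraction of matrices in `S_n` satisfying `p`). -/
def symProb (n : ℕ) (p : Matrix (Fin n) (Fin n) (ZMod 2) → Prop) : ℝ :=
  (((symZeroDiag n).filter p).card : ℝ) / ((symZeroDiag n).card : ℝ)

/-- The principal submatrix `A[S]` of `A` on the rows and columns indexed by `S`. -/
def principalSub {n : ℕ} (A : Matrix (Fin n) (Fin n) (ZMod 2)) (S : Finset (Fin n)) :
    Matrix ↥S ↥S (ZMod 2) :=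
  A.submatrix (fun i => (i : Fin n)) (fun j => (j : Fin n))

/-- The additive group underlying `symZeroDiag n`. -/
def symZeroDiagSubgroup (n : ℕ) : AddSubgroup (Matrix (Fin n) (Fin n) (ZMod 2)) where
  carrier := {A | A.IsSymm ∧ ∀ i, A i i = 0}
  zero_mem' := ⟨Matrix.isSymm_zero, fun _ => rfl⟩
  add_mem' := fun ha hb => ⟨ha.1.add hb.1, fun i => by simp [ha.2 i, hb.2 i]⟩
  neg_mem' := fun ha => ⟨ha.1.neg, fun i => by simp [ha.2 i]⟩

lemma mem_symZeroDiag {n : ℕ} {A : Matrix (Fin n) (Fin n) (ZMod 2)} :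
    A ∈ symZeroDiag n ↔ A ∈ symZeroDiagSubgroup n := by
  simp [symZeroDiag, symZeroDiagSubgroup, ← AddSubgroup.mem_carrier]

/-- The largest rank deficiency of a principal submatrix. -/
def maxDeficiency {n : ℕ} (A : Matrix (Fin n) (Fin n) (ZMod 2)) : ℕ :=
  (Finset.univ : Finset (Finset (Fin n))).sup fun S => S.card - (principalSub A S).rank

lemma card_sub_rank_submatrix_le_maxDeficiency {n : ℕ} (A : Matrix (Fin n) (Fin n) (ZMod 2))
    {ι : Type*} [Fintype ι] [DecidableEq ι] {τ : ι → Fin n} (hτ : Function.Injective τ) :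
    Fintype.card ι - (A.submatrix τ τ).rank ≤ maxDeficiency A := by
  classical
  let S : Finset (Fin n) := Finset.univ.image τ
  let f : ι ≃ S := Equiv.ofBijective (fun i => ⟨τ i, by simp [S]⟩)
    ⟨fun i j h => hτ (by simpa using h), fun ⟨x, hx⟩ => by
      obtain ⟨i, -, rfl⟩ := Finset.mem_image.1 hx
      exact ⟨i, rfl⟩⟩
  have hS : S.card = Fintype.card ι := by
    rw [Finset.card_image_of_injective _ hτ, Finset.card_univ]
  have hr : (A.submatrix τ τ).rank = (principalSub A S).rank := by
    rw [← Matrix.rank_submatrix (principalSub A S) f f]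
    rfl
  rw [← hS, hr]
  exact Finset.le_sup (f := fun S : Finset (Fin n) => S.card - (principalSub A S).rank)
    (Finset.mem_univ S)

/-- A subgroup `H` with the same image under `f` as `V` is equidistributed in `V` with respect
to every event that depends only on `f`. -/
lemma card_filter_mul_card_eq_of_surj {G W : Type*} [AddCommGroup G] [Fintype G]
    [AddCommGroup W] (f : G →+ W) {H V : AddSubgroup G} (hHV : H ≤ V)
    (hsurj : ∀ a ∈ V, ∃ h ∈ H, f h = f a) (q : W → Prop) :
    open Classical in
    (Finset.univ.filter fun a => a ∈ H ∧ q (f a)).card *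
        (Finset.univ.filter fun a => a ∈ V).card =
      (Finset.univ.filter fun a => a ∈ H).card *
        (Finset.univ.filter fun a => a ∈ V ∧ q (f a)).card := by
  classical
  have fiber : ∀ (K : AddSubgroup G) (b : G), (∃ a ∈ K, f a = f b) →
      (Finset.univ.filter fun a => a ∈ K ∧ f a = f b).card =
        (Finset.univ.filter fun a => a ∈ K ∧ f a = 0).card := by
    rintro K b ⟨c, hc, hcb⟩
    refine Finset.card_bij' (fun a _ => a - c) (fun a _ => a + c) ?_ ?_ ?_ ?_
    · intro a ha
      simp only [Finset.mem_filter, Finset.mem_univ, true_and] at ha ⊢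
      exact ⟨K.sub_mem ha.1 hc, by rw [map_sub, ha.2, hcb, sub_self]⟩
    · intro a ha
      simp only [Finset.mem_filter, Finset.mem_univ, true_and] at ha ⊢
      exact ⟨K.add_mem ha.1 hc, by rw [map_add, ha.2, hcb, zero_add]⟩
    · intros; simp
    · intros; simp
  have key : ∀ q : W → Prop,
      (Finset.univ.filter fun a => a ∈ H ∧ q (f a)).card *
          (Finset.univ.filter fun a => a ∈ V ∧ f a = 0).card =
        (Finset.univ.filter fun a => a ∈ V ∧ q (f a)).card *
          (Finset.univ.filter fun a => a ∈ H ∧ f a = 0).card := by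
    intro q
    refine Finset.card_mul_eq_card_mul (fun h a => f h = f a) ?_ ?_ |>.trans rfl
    · intro h hh
      simp only [Finset.mem_filter, Finset.mem_univ, true_and] at hh
      rw [← fiber V h ⟨h, hHV hh.1, rfl⟩]
      congr 1
      ext a
      simp only [Finset.mem_bipartiteAbove, Finset.mem_filter, Finset.mem_univ, true_and]
      constructor
      · rintro ⟨⟨h1, h2⟩, h3⟩; exact ⟨h1, h3.symm⟩
      · rintro ⟨h1, h2⟩; exact ⟨⟨h1, by rw [h2]; exact hh.2⟩, h2.symm⟩
    · intro a ha
      simp only [Finset.mem_filter, Finset.mem_univ, true_and] at ha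
      rw [← fiber H a (hsurj a ha.1)]
      congr 1
      ext h
      simp only [Finset.mem_bipartiteBelow, Finset.mem_filter, Finset.mem_univ, true_and]
      constructor
      · rintro ⟨⟨h1, h2⟩, h3⟩; exact ⟨h1, h3⟩
      · rintro ⟨h1, h2⟩; exact ⟨⟨h1, by rw [h2]; exact ha.2⟩, h2⟩
  have h1 := key q
  have h2 := key fun _ => True
  simp only [and_true] at h2
  have hpos : 0 < (Finset.univ.filter fun a => a ∈ V ∧ f a = 0).card :=
    Finset.card_pos.2 ⟨0, by simp⟩
  refine Nat.eq_of_mul_eq_mul_right hpos ?_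
  calc _ = ((Finset.univ.filter fun a => a ∈ H ∧ q (f a)).card *
          (Finset.univ.filter fun a => a ∈ V ∧ f a = 0).card) *
          (Finset.univ.filter fun a => a ∈ V).card := by ring
    _ = (Finset.univ.filter fun a => a ∈ V ∧ q (f a)).card *
        ((Finset.univ.filter fun a => a ∈ V).card *
          (Finset.univ.filter fun a => a ∈ H ∧ f a = 0).card) := by rw [h1]; ring
    _ = _ := by rw [← h2]; ring

lemma dotProduct_mulVec_self_eq_zero {n : ℕ} {A : Matrix (Fin n) (Fin n) (ZMod 2)}
    (hA : A ∈ symZeroDiagSubgroup n) (x : Fin n → ZMod 2) : x ⬝ᵥ A.mulVec x = 0 := by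
  simp only [dotProduct, Matrix.mulVec, Finset.mul_sum]
  rw [← Finset.sum_product']
  refine Finset.sum_involution (fun p _ => (p.2, p.1)) ?_ ?_ ?_ ?_
  · rintro ⟨i, j⟩ -
    have : A j i = A i j := hA.1.apply i j
    simp only [this]
    rw [show x j * (A i j * x i) = x i * (A i j * x j) by ring]
    exact CharTwo.add_self_eq_zero _
  · rintro ⟨i, j⟩ - h heq
    obtain rfl : j = i := congrArg Prod.fst heq
    simp [hA.2 j] at h
  · simp
  · simp

lemma transpose_mul_mul_mem {n : ℕ} {A : Matrix (Fin n) (Fin n) (ZMod 2)}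
    (hA : A ∈ symZeroDiagSubgroup n) (P : Matrix (Fin n) (Fin n) (ZMod 2)) :
    P.transpose * A * P ∈ symZeroDiagSubgroup n := by
  refine ⟨?_, fun i => ?_⟩
  · rw [Matrix.IsSymm, Matrix.transpose_mul, Matrix.transpose_mul, Matrix.transpose_transpose,
      hA.1.eq, Matrix.mul_assoc]
  · rw [← dotProduct_mulVec_self_eq_zero hA (P.col i), Matrix.mul_assoc]
    simp [Matrix.mul_apply, dotProduct, Matrix.mulVec]

/-- If no nonzero combination of the columns of `Z` is supported on the range of `τ`, then some
matrix is the identity on the range of `τ` and annihilates the columns of `Z`. -/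
lemma exists_projection {n : ℕ} {β κ : Type*} [Fintype κ] (τ : β → Fin n)
    (Z : Matrix (Fin n) κ (ZMod 2))
    (hZ : ∀ v : κ → ZMod 2, v ≠ 0 → ∃ i, i ∉ Set.range τ ∧ Z.mulVec v i ≠ 0) :
    ∃ P : Matrix (Fin n) (Fin n) (ZMod 2), P * Z = 0 ∧
      P.submatrix id τ = (1 : Matrix (Fin n) (Fin n) (ZMod 2)).submatrix id τ := by
  classical
  let W : Submodule (ZMod 2) (Fin n → ZMod 2) :=
    { carrier := {x | ∀ i, i ∉ Set.range τ → x i = 0}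
      zero_mem' := fun _ _ => rfl
      add_mem' := fun ha hb i hi => by simp [ha i hi, hb i hi]
      smul_mem' := fun c x hx i hi => by simp [hx i hi] }
  let U := LinearMap.range Z.mulVecLin
  have hker : LinearMap.ker (U.mkQ ∘ₗ W.subtype) = ⊥ := by
    rw [LinearMap.ker_eq_bot']
    rintro ⟨x, hx⟩ h
    have hxU : x ∈ U := by simpa using h
    obtain ⟨v, rfl⟩ := hxU
    by_cases hv : v = 0
    · subst hv; ext; simp
    · obtain ⟨i, hi, hne⟩ := hZ v hv
      exact absurd (hx i hi) hne
  obtain ⟨g, hg⟩ := LinearMap.exists_leftInverse_of_injective _ hker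
  let p : (Fin n → ZMod 2) →ₗ[ZMod 2] (Fin n → ZMod 2) := W.subtype ∘ₗ g ∘ₗ U.mkQ
  have hpU : ∀ v, p (Z.mulVec v) = 0 := fun v => by
    have : U.mkQ (Z.mulVec v) = 0 := by
      rw [Submodule.mkQ_apply, Submodule.Quotient.mk_eq_zero]; exact ⟨v, rfl⟩
    simp only [p, LinearMap.comp_apply, this, map_zero]
  have hpW : ∀ x (_ : x ∈ W), p x = x := fun x hx => by
    have := LinearMap.congr_fun hg ⟨x, hx⟩
    simpa [p] using congrArg Subtype.val this
  refine ⟨LinearMap.toMatrix' p, ?_, ?_⟩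
  · refine Matrix.toLin'.injective (LinearMap.ext fun v => ?_)
    simp [hpU]
  · ext i b
    have hb : (Pi.single (τ b) 1 : Fin n → ZMod 2) ∈ W := fun i hi =>
      Pi.single_eq_of_ne (fun h => hi ⟨b, h.symm⟩) _
    rw [Matrix.submatrix_apply, Matrix.submatrix_apply, LinearMap.toMatrix'_apply,
      hpW _ hb]
    simp [Matrix.one_apply, Pi.single_apply]

/-- The zero-diagonal symmetric matrices whose principal submatrix along `σ` annihilates `Z`. -/
def annihilatorSubgroup {n : ℕ} {ι κ : Type*} [Fintype ι] (σ : ι → Fin n)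
    (Z : Matrix ι κ (ZMod 2)) : AddSubgroup (Matrix (Fin n) (Fin n) (ZMod 2)) where
  carrier := {A | A ∈ symZeroDiagSubgroup n ∧ A.submatrix σ σ * Z = 0}
  zero_mem' := ⟨zero_mem _, by simp⟩
  add_mem' := fun {a b} ha hb => ⟨add_mem ha.1 hb.1, by
    rw [Matrix.submatrix_add, Pi.add_apply, Pi.add_apply, Matrix.add_mul, ha.2, hb.2, add_zero]⟩
  neg_mem' := fun {a} ha => ⟨neg_mem ha.1, by
    rw [Matrix.submatrix_neg, Pi.neg_apply, Pi.neg_apply, Matrix.neg_mul, ha.2, neg_zero]⟩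

lemma exists_mem_annihilatorSubgroup_submatrix_eq {n : ℕ} {ι κ β : Type*} [Fintype ι]
    [Fintype κ] {σ : ι → Fin n} (hσ : Function.Injective σ) (Z : Matrix ι κ (ZMod 2))
    (τ : β → Fin n)
    (hZ : ∀ v : κ → ZMod 2, v ≠ 0 → ∃ j, σ j ∉ Set.range τ ∧ Z.mulVec v j ≠ 0)
    {A : Matrix (Fin n) (Fin n) (ZMod 2)} (hA : A ∈ symZeroDiagSubgroup n) :
    ∃ B ∈ annihilatorSubgroup σ Z, B.submatrix τ τ = A.submatrix τ τ := by
  classical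
  let J : Matrix (Fin n) ι (ZMod 2) := (1 : Matrix (Fin n) (Fin n) (ZMod 2)).submatrix id σ
  have hJ : ∀ (x : ι → ZMod 2) (j : ι), J.mulVec x (σ j) = x j := fun x j => by
    simp [J, Matrix.mulVec, dotProduct, Matrix.one_apply, hσ.eq_iff]
  obtain ⟨P, hPZ, hPτ⟩ := exists_projection τ (J * Z) fun v hv => by
    obtain ⟨j, hj, hne⟩ := hZ v hv
    exact ⟨σ j, hj, by rwa [← Matrix.mulVec_mulVec, hJ]⟩
  refine ⟨P.transpose * A * P, ⟨transpose_mul_mul_mem hA P, ?_⟩, ?_⟩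
  · have h : P.transpose * A * P * (J * Z) = 0 := by rw [Matrix.mul_assoc, hPZ, Matrix.mul_zero]
    have hs : (P.transpose * A * P).submatrix σ σ * Z =
        (P.transpose * A * P * (J * Z)).submatrix σ id := by
      rw [← Matrix.mul_assoc]
      ext i c
      simp [J, Matrix.mul_apply, Matrix.one_apply]
    rw [hs, h]; rfl
  · have h : (P.transpose * A * P).submatrix τ τ =
        (P.submatrix id τ).transpose * A * P.submatrix id τ := rfl
    rw [h, hPτ]
    ext i j
    simp [Matrix.mul_apply, Matrix.one_apply]

lemma sum_sum_mul_add_diagonal {I : Type*} [Fintype I] [DecidableEq I] (s : I → ℝ) (c : ℝ) :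
    ∑ w, ∑ w', (s w * s w' + if w = w' then c * s w else 0) =
      (∑ w, s w) * (∑ w, s w) + c * ∑ w, s w := by
  rw [Finset.sum_mul_sum]
  simp [Finset.sum_add_distrib, Finset.mul_sum]

/-- The Cauchy–Schwarz step of the second moment method, for a sum `S` of nonnegative values
with second moment `R` whose support has `q` elements out of `v`. -/
lemma le_eight_mul_of_second_moment {v q T S R : ℝ} (hv : 0 < v) (hq : 0 ≤ q) (hT : 0 < T)
    (hTS : T ≤ 2 * S) (hR : R * v ≤ 2 * T ^ 2) (hSR : S ^ 2 ≤ q * R) : v ≤ 8 * q := by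
  have hsq : T ^ 2 ≤ (2 * S) ^ 2 := pow_le_pow_left₀ hT.le hTS 2
  have h1 : T ^ 2 * v ≤ 4 * (q * R) * v := mul_le_mul_of_nonneg_right (by linarith) hv.le
  have h2 : q * (R * v) ≤ q * (2 * T ^ 2) := mul_le_mul_of_nonneg_left hR hq
  refine le_of_mul_le_mul_left ?_ (pow_pos hT 2)
  linarith

/-- A second moment bound: almost independent events indexed by `(w, y)`, each compatible at
least half of the time with a condition `p w` bounding their multiplicity, cannot all fail often. -/
lemma card_le_eight_mul_card_exists {α I J : Type*} [Fintype I] [DecidableEq I]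
    (V : Finset α) (G : Finset J) (E : I → J → α → Prop) (p : I → α → Prop) (b : ℕ)
    (hb : 0 < b) (hV : 0 < V.card) :
    open Classical in
    (∀ w, ∀ y ∈ G, (V.filter fun a => E w y a).card ≤
        2 * (V.filter fun a => E w y a ∧ p w a).card) →
    (∀ w w', w ≠ w' → ∀ y ∈ G, ∀ y' ∈ G,
      (V.filter fun a => E w y a ∧ E w' y' a).card * V.card ≤
        (V.filter fun a => E w y a).card * (V.filter fun a => E w' y' a).card) →
    (∀ w, ∀ a ∈ V, p w a → (G.filter fun y => E w y a).card ≤ b) →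
    b * V.card ≤ ∑ w, ∑ y ∈ G, (V.filter fun a => E w y a).card →
    V.card ≤ 8 * (V.filter fun a => ∃ w, ∃ y ∈ G, E w y a).card := by
  classical
  intro h1 h2 h3 h4
  let N : I → α → ℝ := fun w a => ∑ y ∈ G, if E w y a ∧ p w a then 1 else 0
  let X : α → ℝ := fun a => ∑ w, N w a
  let m : I → J → ℝ := fun w y => ((V.filter fun a => E w y a).card : ℝ)
  let T : ℝ := ∑ w, ∑ y ∈ G, m w y
  have hN0 : ∀ w a, 0 ≤ N w a := fun w a =>
    Finset.sum_nonneg fun y _ => by split_ifs <;> norm_num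
  have hsumN : ∀ w, ∑ a ∈ V, N w a =
      ∑ y ∈ G, ((V.filter fun a => E w y a ∧ p w a).card : ℝ) := fun w => by
    simp only [N]
    rw [Finset.sum_comm]
    simp
  have hNle : ∀ w, ∑ a ∈ V, N w a ≤ ∑ y ∈ G, m w y := fun w => by
    rw [hsumN]
    refine Finset.sum_le_sum fun y _ => ?_
    simp only [m]
    refine Nat.cast_le.2 (Finset.card_le_card fun a ha => ?_)
    rw [Finset.mem_filter] at ha ⊢
    exact ⟨ha.1, ha.2.1⟩
  have hT : (b : ℝ) * V.card ≤ T := by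
    simp only [T, m]
    exact_mod_cast h4
  have hbR : (0 : ℝ) < b := by exact_mod_cast hb
  have hVR : (0 : ℝ) < V.card := by exact_mod_cast hV
  have hTpos : 0 < T := lt_of_lt_of_le (by positivity) hT
  have hfirst : T ≤ 2 * ∑ a ∈ V, X a := by
    simp only [X]
    rw [Finset.sum_comm, Finset.mul_sum]
    refine Finset.sum_le_sum fun w _ => ?_
    rw [hsumN, Finset.mul_sum]
    refine Finset.sum_le_sum fun y hy => ?_
    simp only [m]
    exact_mod_cast h1 w y hy
  have hdiag : ∀ w, ∑ a ∈ V, N w a * N w a ≤ b * ∑ y ∈ G, m w y := fun w => by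
    refine le_trans ?_ (mul_le_mul_of_nonneg_left (hNle w) hbR.le)
    rw [Finset.mul_sum]
    refine Finset.sum_le_sum fun a ha => mul_le_mul_of_nonneg_right ?_ (hN0 w a)
    by_cases hp : p w a
    · simp only [N, hp, and_true, Finset.sum_boole]
      exact_mod_cast h3 w a ha hp
    · simp only [N, hp, and_false, if_false, Finset.sum_const_zero]
      exact hbR.le
  have hoff : ∀ w w', w ≠ w' →
      (∑ a ∈ V, N w a * N w' a) * V.card ≤ (∑ y ∈ G, m w y) * ∑ y ∈ G, m w' y := by
    intro w w' hww
    have : ∑ a ∈ V, N w a * N w' a ≤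
        ∑ y ∈ G, ∑ y' ∈ G, ((V.filter fun a => E w y a ∧ E w' y' a).card : ℝ) := by
      simp only [N, Finset.sum_mul_sum]
      rw [Finset.sum_comm]
      refine Finset.sum_le_sum fun y _ => ?_
      rw [Finset.sum_comm]
      refine Finset.sum_le_sum fun y' _ => ?_
      rw [← Finset.sum_boole]
      refine Finset.sum_le_sum fun a _ => ?_
      by_cases ha : E w y a <;> by_cases hb : E w' y' a <;>
        by_cases hc : p w a <;> by_cases hd : p w' a <;> simp [ha, hb, hc, hd]
    refine (mul_le_mul_of_nonneg_right this hVR.le).trans ?_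
    rw [Finset.sum_mul_sum, Finset.sum_mul]
    refine Finset.sum_le_sum fun y hy => ?_
    rw [Finset.sum_mul]
    refine Finset.sum_le_sum fun y' hy' => ?_
    simp only [m]
    exact_mod_cast h2 w w' hww y hy y' hy'
  have hsecond : (∑ a ∈ V, X a ^ 2) * V.card ≤ 2 * T ^ 2 := by
    have hpair : ∀ w w', (∑ a ∈ V, N w a * N w' a) * V.card ≤
        (∑ y ∈ G, m w y) * (∑ y ∈ G, m w' y) +
          if w = w' then b * V.card * ∑ y ∈ G, m w y else 0 := by
      intro w w'
      by_cases h : w = w'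
      · subst h
        rw [if_pos rfl]
        have := mul_le_mul_of_nonneg_right (hdiag w) hVR.le
        nlinarith [mul_self_nonneg (∑ y ∈ G, m w y)]
      · rw [if_neg h, add_zero]
        exact hoff w w' h
    calc (∑ a ∈ V, X a ^ 2) * V.card
        = ∑ w, ∑ w', (∑ a ∈ V, N w a * N w' a) * V.card := by
          simp only [X, sq, Finset.sum_mul_sum, ← Finset.sum_mul]
          congr 1
          rw [Finset.sum_comm]
          exact Finset.sum_congr rfl fun w _ => Finset.sum_comm
      _ ≤ ∑ w, ∑ w', ((∑ y ∈ G, m w y) * (∑ y ∈ G, m w' y) +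
          if w = w' then b * V.card * ∑ y ∈ G, m w y else 0) :=
          Finset.sum_le_sum fun w _ => Finset.sum_le_sum fun w' _ => hpair w w'
      _ = T * T + b * V.card * T := sum_sum_mul_add_diagonal (fun w => ∑ y ∈ G, m w y) _
      _ ≤ 2 * T ^ 2 := by nlinarith
  let Q := V.filter fun a => ∃ w, ∃ y ∈ G, E w y a
  have hQ : ∑ a ∈ V, X a = ∑ a ∈ Q, X a := by
    symm
    refine Finset.sum_subset (Finset.filter_subset _ _) fun a ha hna => ?_
    refine Finset.sum_eq_zero fun w _ => Finset.sum_eq_zero fun y hy => if_neg fun h => hna ?_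
    exact Finset.mem_filter.2 ⟨ha, w, y, hy, h.1⟩
  have hCS : (∑ a ∈ V, X a) ^ 2 ≤ Q.card * ∑ a ∈ V, X a ^ 2 := by
    rw [hQ]
    refine sq_sum_le_card_mul_sum_sq.trans (mul_le_mul_of_nonneg_left ?_ (Nat.cast_nonneg _))
    exact Finset.sum_le_sum_of_subset_of_nonneg (Finset.filter_subset _ _)
      fun a _ _ => sq_nonneg _
  have := le_eight_mul_of_second_moment hVR (Nat.cast_nonneg Q.card) hTpos hfirst hsecond hCS
  exact_mod_cast this

/-- Most block matrices have all blocks injective. -/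
lemma card_le_two_mul_card_blocks_injective {t r k : ℕ} (h : 2 * t * 2 ^ k ≤ 2 ^ r) :
    open Classical in
    2 ^ (k * (t * r)) ≤ 2 * (Finset.univ.filter
      fun Y : Matrix (Fin t × Fin r) (Fin k) (ZMod 2) =>
        ∀ a, ∀ v : Fin k → ZMod 2, v ≠ 0 → ∃ b, Y.mulVec v (a, b) ≠ 0).card := by
  classical
  let bad : Fin t → (Fin k → ZMod 2) → Finset (Matrix (Fin t × Fin r) (Fin k) (ZMod 2)) :=
    fun a v => Finset.univ.filter fun Y => ∀ b, Y.mulVec v (a, b) = 0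
  let good := Finset.univ.filter
      fun Y : Matrix (Fin t × Fin r) (Fin k) (ZMod 2) =>
        ∀ a, ∀ v : Fin k → ZMod 2, v ≠ 0 → ∃ b, Y.mulVec v (a, b) ≠ 0
  have hcard : Fintype.card (Matrix (Fin t × Fin r) (Fin k) (ZMod 2)) = 2 ^ (k * (t * r)) := by
    
    change Fintype.card (Fin t × Fin r → Fin k → ZMod 2) = _
    simp [← pow_mul]
  have hbad : ∀ a v, v ≠ 0 → (bad a v).card * 2 ^ r = 2 ^ (k * (t * r)) := by
    intro a v hv
    obtain ⟨c, hc⟩ := Function.ne_iff.1 hv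
    have hc1 : v c = 1 := by
      have hx : ∀ x : ZMod 2, x ≠ 0 → x = 1 := by decide
      exact hx _ hc
    let f : Matrix (Fin t × Fin r) (Fin k) (ZMod 2) →+ (Fin r → ZMod 2) :=
      { toFun := fun Y b => Y.mulVec v (a, b)
        map_zero' := by ext; simp
        map_add' := fun Y Y' => by ext; simp [Matrix.add_mulVec] }
    have hf : Function.Surjective f := by
      intro x
      refine ⟨Matrix.of fun p j => if j = c then x p.2 else 0, ?_⟩
      ext b
      simp [f, Matrix.mulVec, dotProduct, hc1]
    have hmem : ∀ x, (Finset.univ.filter fun Y => f Y = x).card = (bad a v).card := by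
      intro x
      have := AddMonoidHom.card_fiber_eq_of_mem_range f (x := x) (y := 0) (hf x) (hf 0)
      rw [this]
      congr 1
      ext Y
      simp [f, bad, funext_iff]
    have := Finset.card_eq_sum_card_fiberwise (f := f)
      (s := Finset.univ) (t := Finset.univ) (fun _ _ => by simp)
    rw [Finset.sum_congr rfl fun x _ => hmem x, Finset.card_univ, hcard] at this
    simpa [mul_comm] using this.symm
  have hcover : Finset.univ ⊆ good ∪
      (Finset.univ : Finset (Fin t)).biUnion fun a =>
        (Finset.univ.erase (0 : Fin k → ZMod 2)).biUnion fun v => bad a v := by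
    intro Y _
    by_cases hY : Y ∈ good
    · exact Finset.mem_union_left _ hY
    · refine Finset.mem_union_right _ ?_
      simp only [good, Finset.mem_filter, Finset.mem_univ, true_and] at hY
      push Not at hY
      obtain ⟨a, v, hv, hb⟩ := hY
      simp only [Finset.mem_biUnion, Finset.mem_univ, true_and, Finset.mem_erase, bad,
        Finset.mem_filter]
      exact ⟨a, v, ⟨hv, trivial⟩, hb⟩
  have hle := Finset.card_le_card hcover
  rw [Finset.card_univ, hcard] at hle
  have hb2 : ((Finset.univ : Finset (Fin t)).biUnion fun a =>
        (Finset.univ.erase (0 : Fin k → ZMod 2)).biUnion fun v => bad a v).card * 2 ^ r ≤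
      t * (2 ^ k * 2 ^ (k * (t * r))) := by
    refine (Nat.mul_le_mul_right _ Finset.card_biUnion_le).trans ?_
    rw [Finset.sum_mul]
    refine (Finset.sum_le_card_nsmul _ _ (2 ^ k * 2 ^ (k * (t * r))) fun a _ => ?_).trans
      (by simp)
    refine (Nat.mul_le_mul_right _ Finset.card_biUnion_le).trans ?_
    rw [Finset.sum_mul]
    refine (Finset.sum_le_card_nsmul _ _ (2 ^ (k * (t * r))) fun v hv =>
      (hbad a v (Finset.ne_of_mem_erase hv)).le).trans ?_
    rw [smul_eq_mul]
    refine Nat.mul_le_mul_right _ ((Finset.card_le_univ _).trans ?_)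
    simp
  have hu := hle.trans (Finset.card_union_le _ _)
  change _ ≤ 2 * good.card
  set B := ((Finset.univ : Finset (Fin t)).biUnion fun a =>
        (Finset.univ.erase (0 : Fin k → ZMod 2)).biUnion fun v => bad a v).card
  have hB : 2 * B ≤ 2 ^ (k * (t * r)) := by
    refine Nat.le_of_mul_le_mul_right ?_ (show 0 < 2 ^ r by positivity)
    calc 2 * B * 2 ^ r = 2 * (B * 2 ^ r) := by ring
      _ ≤ 2 * (t * (2 ^ k * 2 ^ (k * (t * r)))) := Nat.mul_le_mul_left _ hb2
      _ = (2 * t * 2 ^ k) * 2 ^ (k * (t * r)) := by ring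
      _ ≤ 2 ^ r * 2 ^ (k * (t * r)) := Nat.mul_le_mul_right _ h
      _ = _ := mul_comm _ _
  omega

lemma card_symZeroDiagSubgroup_le {n : ℕ} {ι κ : Type*} [Fintype ι] [Fintype κ]
    (σ : ι → Fin n) (Z : Matrix ι κ (ZMod 2)) :
    open Classical in
    (Finset.univ.filter fun A => A ∈ symZeroDiagSubgroup n).card ≤
      (Finset.univ.filter fun A => A ∈ annihilatorSubgroup σ Z).card *
        2 ^ (Fintype.card ι * Fintype.card κ) := by
  classical
  have hcard : Fintype.card (Matrix ι κ (ZMod 2)) = 2 ^ (Fintype.card ι * Fintype.card κ) := by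
    change Fintype.card (ι → κ → ZMod 2) = _
    simp [← pow_mul, mul_comm]
  rw [← hcard, ← Finset.card_univ]
  refine Finset.card_le_mul_card_image_of_maps_to
    (f := fun A : Matrix (Fin n) (Fin n) (ZMod 2) => A.submatrix σ σ * Z)
    (fun _ _ => Finset.mem_univ _) _ fun C _ => ?_
  rcases Finset.eq_empty_or_nonempty ((Finset.univ.filter fun A =>
    A ∈ symZeroDiagSubgroup n).filter fun A => A.submatrix σ σ * Z = C) with h | ⟨A₀, h₀⟩
  · rw [h]; simp
  · simp only [Finset.mem_filter, Finset.mem_univ, true_and] at h₀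
    refine Finset.card_le_card_of_injOn (fun A => A - A₀) (fun A hA => ?_)
      fun _ _ _ _ h => sub_left_injective h
    simp only [Finset.coe_filter, Finset.mem_filter, Finset.mem_univ, true_and,
      Set.mem_ofPred_eq] at hA ⊢
    refine ⟨sub_mem hA.1 h₀.1, ?_⟩
    rw [Matrix.submatrix_sub, Pi.sub_apply, Pi.sub_apply, Matrix.sub_mul, hA.2, h₀.2, sub_self]

lemma card_mul_eq_le {ι : Type*} [Fintype ι] [DecidableEq ι] {k : ℕ} (R : Matrix ι ι (ZMod 2))
    (hR : Fintype.card ι - R.rank ≤ k) (C : Matrix ι (Fin k) (ZMod 2)) :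
    (Finset.univ.filter fun Y : Matrix ι (Fin k) (ZMod 2) => R * Y = C).card ≤ 2 ^ (k * k) := by
  classical
  let K := LinearMap.ker R.mulVecLin
  have hK : Fintype.card K ≤ 2 ^ k := by
    rw [Module.card_eq_pow_finrank (K := ZMod 2), ZMod.card]
    refine Nat.pow_le_pow_right two_pos ?_
    have h := R.mulVecLin.finrank_range_add_finrank_ker
    rw [Module.finrank_pi] at h
    have hr : R.rank = Module.finrank (ZMod 2) (LinearMap.range R.mulVecLin) := rfl
    simp only [K]
    omega
  rcases Finset.eq_empty_or_nonempty (Finset.univ.filter fun Y : Matrix ι (Fin k) (ZMod 2) =>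
    R * Y = C) with h | ⟨Y₀, h₀⟩
  · rw [h]; simp
  · simp only [Finset.mem_filter, Finset.mem_univ, true_and] at h₀
    have hmem : ∀ Y : Matrix ι (Fin k) (ZMod 2), R * Y = C → ∀ j, (Y - Y₀).col j ∈ K := by
      intro Y hY j
      have h : R * (Y - Y₀) = 0 := by rw [Matrix.mul_sub, hY, h₀, sub_self]
      ext i
      exact congrFun (congrFun h i) j
    calc (Finset.univ.filter fun Y : Matrix ι (Fin k) (ZMod 2) => R * Y = C).card
        ≤ (Finset.univ : Finset (Fin k → K)).card := by
          refine Finset.card_le_card_of_injOn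
            (fun Y j => if h : R * Y = C then ⟨(Y - Y₀).col j, hmem Y h j⟩ else 0)
            (fun _ _ => Finset.mem_coe.2 (Finset.mem_univ _)) fun Y hY Y' hY' h => ?_
          simp only [Finset.coe_filter, Finset.mem_univ, true_and, Set.mem_ofPred_eq] at hY hY'
          ext i j
          have hj := congrArg (fun f => (f j : ι → ZMod 2) i) h
          simpa [hY, hY'] using hj
      _ = Fintype.card K ^ k := by simp
      _ ≤ (2 ^ k) ^ k := Nat.pow_le_pow_left hK k
      _ = 2 ^ (k * k) := (pow_mul 2 k k).symm

lemma le_card_sub_rank_of_mul_fromRows_one_eq_zero {L : Type*} [Fintype L] {k : ℕ}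
    (M : Matrix (Fin k ⊕ L) (Fin k ⊕ L) (ZMod 2)) (Y : Matrix L (Fin k) (ZMod 2))
    (h : M * Matrix.fromRows (1 : Matrix (Fin k) (Fin k) (ZMod 2)) Y = 0) : k ≤ Fintype.card (Fin k ⊕ L) - M.rank := by
  classical
  let f : (Fin k → ZMod 2) →ₗ[ZMod 2] LinearMap.ker M.mulVecLin :=
    (Matrix.fromRows (1 : Matrix (Fin k) (Fin k) (ZMod 2)) Y).mulVecLin.codRestrict _ fun v => by
      change M.mulVec ((Matrix.fromRows 1 Y).mulVec v) = 0
      rw [Matrix.mulVec_mulVec, h, Matrix.zero_mulVec]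
  have hf : Function.Injective f := fun v v' hv => by
    have := congrArg (fun x : LinearMap.ker M.mulVecLin => (x : Fin k ⊕ L → ZMod 2)) hv
    ext j
    simpa [f, Matrix.fromRows_mulVec] using congrFun this (Sum.inl j)
  have hle := LinearMap.finrank_le_finrank_of_injective hf
  have hrn := M.mulVecLin.finrank_range_add_finrank_ker
  rw [Module.finrank_pi] at hrn hle
  have hr : M.rank = Module.finrank (ZMod 2) (LinearMap.range M.mulVecLin) := rfl
  rw [Fintype.card_fin] at hle
  omega

lemma toBlocks_mul_eq_neg_of_mul_fromRows_one_eq_zero {L : Type*} [Fintype L] {k : ℕ}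
    (M : Matrix (Fin k ⊕ L) (Fin k ⊕ L) (ZMod 2)) (Y : Matrix L (Fin k) (ZMod 2))
    (h : M * Matrix.fromRows (1 : Matrix (Fin k) (Fin k) (ZMod 2)) Y = 0) :
    M.toBlocks₂₂ * Y = -M.toBlocks₂₁ := by
  ext x j
  have hx := congrFun (congrFun h (Sum.inr x)) j
  simp only [Matrix.mul_apply, Fintype.sum_sum_type, Matrix.fromRows_apply_inl,
    Matrix.fromRows_apply_inr, Matrix.one_apply, mul_ite, mul_one, mul_zero,
    Finset.sum_ite_eq', Finset.mem_univ, if_true, Matrix.zero_apply] at hx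
  rw [Matrix.neg_apply, eq_neg_iff_add_eq_zero, add_comm]
  simpa [Matrix.mul_apply, Matrix.toBlocks₂₁, Matrix.toBlocks₂₂] using hx

/-- The vertex set selected by the word `w`: the common part together with, for every position
`(a, b)`, one of two vertices according to the letter `w a`. -/
def wordEmbedding {n k t r : ℕ} (e : Fin k ⊕ (Fin t × Fin r × Bool) ↪ Fin n)
    (w : Fin t → Bool) : Fin k ⊕ (Fin t × Fin r) → Fin n :=
  Sum.elim (fun i => e (Sum.inl i)) fun p => e (Sum.inr (p.1, p.2, w p.1))

lemma wordEmbedding_injective {n k t r : ℕ} (e : Fin k ⊕ (Fin t × Fin r × Bool) ↪ Fin n)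
    (w : Fin t → Bool) : Function.Injective (wordEmbedding e w) := by
  rintro (i | ⟨a, b⟩) (j | ⟨c, d⟩) h <;> simp_all [wordEmbedding]

lemma wordEmbedding_notMem_range {n k t r : ℕ} (e : Fin k ⊕ (Fin t × Fin r × Bool) ↪ Fin n)
    {w w' : Fin t → Bool} {a : Fin t} (h : w a ≠ w' a) (b : Fin r) :
    wordEmbedding e w (Sum.inr (a, b)) ∉ Set.range (wordEmbedding e w') := by
  rintro ⟨i | ⟨c, d⟩, hj⟩
  · simp [wordEmbedding] at hj
  · simp only [wordEmbedding, Sum.elim_inr, EmbeddingLike.apply_eq_iff_eq, Sum.inr.injEq,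
      Prod.mk.injEq] at hj
    obtain ⟨rfl, -, hw⟩ := hj
    exact h hw.symm

lemma card_filter_annihilator_and_mul_card {n : ℕ} {ι κ β : Type*} [Fintype ι] [Fintype κ]
    {σ : ι → Fin n} (hσ : Function.Injective σ) (Z : Matrix ι κ (ZMod 2)) (τ : β → Fin n)
    (hZ : ∀ v : κ → ZMod 2, v ≠ 0 → ∃ j, σ j ∉ Set.range τ ∧ Z.mulVec v j ≠ 0)
    (q : Matrix β β (ZMod 2) → Prop) :
    open Classical in
    ((symZeroDiag n).filter fun A => A ∈ annihilatorSubgroup σ Z ∧ q (A.submatrix τ τ)).card *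
        (symZeroDiag n).card =
      ((symZeroDiag n).filter fun A => A ∈ annihilatorSubgroup σ Z).card *
        ((symZeroDiag n).filter fun A => q (A.submatrix τ τ)).card := by
  classical
  let f : Matrix (Fin n) (Fin n) (ZMod 2) →+ Matrix β β (ZMod 2) :=
    { toFun := fun A => A.submatrix τ τ
      map_zero' := rfl
      map_add' := fun _ _ => rfl }
  have hle : annihilatorSubgroup σ Z ≤ symZeroDiagSubgroup n := fun _ h => h.1
  have key := card_filter_mul_card_eq_of_surj f hle
    (fun A hA => exists_mem_annihilatorSubgroup_submatrix_eq hσ Z τ hZ hA) q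
  convert key using 3
  · ext A
    simp only [Finset.mem_filter, mem_symZeroDiag, Finset.mem_univ, true_and]
    exact ⟨fun h => h.2, fun h => ⟨hle h.1, h⟩⟩
  · ext A
    simp [mem_symZeroDiag]
  · ext A
    simp only [Finset.mem_filter, mem_symZeroDiag, Finset.mem_univ, true_and]
    exact ⟨fun h => h.2, fun h => ⟨hle h, h⟩⟩
  · ext A
    simp only [Finset.mem_filter, mem_symZeroDiag, Finset.mem_univ, true_and]
    exact Iff.rfl

lemma mul_card_le_eight_mul_sum_of_subset {α : Type*} {V Q : Finset α} {f : α → ℕ} {k : ℕ}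
    (hQV : Q ⊆ V) (hf : ∀ a ∈ Q, k ≤ f a) (hV : V.card ≤ 8 * Q.card) :
    k * V.card ≤ 8 * ∑ a ∈ V, f a :=
  calc k * V.card ≤ k * (8 * Q.card) := Nat.mul_le_mul_left _ hV
    _ = 8 * (Q.card • k) := by rw [smul_eq_mul]; ring
    _ ≤ 8 * ∑ a ∈ V, f a := Nat.mul_le_mul_left _ <|
      (Finset.card_nsmul_le_sum _ _ k hf).trans (Finset.sum_le_sum_of_subset hQV)

lemma two_pow_mul_le_of_le {k m t g : ℕ} (hg : 2 ^ (k * m) ≤ 2 * g) (ht : 2 * (k * k) + 1 ≤ t)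
    (v : ℕ) : 2 ^ (k * k) * v * (2 * 2 ^ ((k + m) * k)) ≤ 2 ^ t * (2 * g) * v :=
  calc 2 ^ (k * k) * v * (2 * 2 ^ ((k + m) * k))
      = 2 ^ (2 * (k * k) + 1) * 2 ^ (k * m) * v := by
        rw [mul_right_comm]
        congr 1
        rw [← pow_succ', ← pow_add, ← pow_add]
        congr 1
        ring
    _ ≤ 2 ^ t * (2 * g) * v := by gcongr; norm_num

lemma card_mul_le_eight_mul_sum_maxDeficiency {n k t r : ℕ}
    (e : Fin k ⊕ (Fin t × Fin r × Bool) ↪ Fin n) (hr : 2 * t * 2 ^ k ≤ 2 ^ r)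
    (ht : 2 * (k * k) + 1 ≤ t) :
    k * (symZeroDiag n).card ≤ 8 * ∑ A ∈ symZeroDiag n, maxDeficiency A := by
  classical
  let V := symZeroDiag n
  let σ := wordEmbedding e
  have hσ : ∀ w, Function.Injective (σ w) := wordEmbedding_injective e
  let τ : (Fin t → Bool) → Fin t × Fin r → Fin n := fun w => σ w ∘ Sum.inr
  have hτ : ∀ w, Function.Injective (τ w) := fun w => (hσ w).comp Sum.inr_injective
  obtain ⟨q, hq⟩ : ∃ q : Matrix (Fin t × Fin r) (Fin t × Fin r) (ZMod 2) → Prop,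
      ∀ R, q R ↔ Fintype.card (Fin t × Fin r) - R.rank ≤ k := ⟨_, fun _ => Iff.rfl⟩
  let p : (Fin t → Bool) → Matrix (Fin n) (Fin n) (ZMod 2) → Prop := fun w A =>
    q (A.submatrix (τ w) (τ w))
  by_cases hp : ∀ w, V.card ≤ 2 * (V.filter (p w)).card
  swap
  · push Not at hp
    obtain ⟨w, hw⟩ := hp
    refine mul_card_le_eight_mul_sum_of_subset
      (Finset.filter_subset (fun A => ¬ p w A) V) (fun A hA => ?_) ?_
    · exact (not_le.1 (mt (hq _).2 (Finset.mem_filter.1 hA).2)).le.trans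
        (card_sub_rank_submatrix_le_maxDeficiency A (hτ w))
    · have := Finset.card_filter_add_card_filter_not (s := V) (p w)
      change V.card ≤ _
      omega
  let G := Finset.univ.filter fun Y : Matrix (Fin t × Fin r) (Fin k) (ZMod 2) =>
    ∀ a, ∀ v : Fin k → ZMod 2, v ≠ 0 → ∃ b, Y.mulVec v (a, b) ≠ 0
  have hG : 2 ^ (k * (t * r)) ≤ 2 * G.card := card_le_two_mul_card_blocks_injective hr
  let E : (Fin t → Bool) → Matrix (Fin t × Fin r) (Fin k) (ZMod 2) →
      Matrix (Fin n) (Fin n) (ZMod 2) → Prop := fun w Y A =>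
    A ∈ annihilatorSubgroup (σ w) (Matrix.fromRows 1 Y)
  have hVpos : 0 < V.card :=
    Finset.card_pos.2 ⟨0, mem_symZeroDiag.2 (zero_mem _)⟩
  refine mul_card_le_eight_mul_sum_of_subset (Finset.filter_subset _ _) ?_ <|
    card_le_eight_mul_card_exists V G E p (2 ^ (k * k)) (by positivity) hVpos ?_ ?_ ?_ ?_
  · intro A hA
    obtain ⟨-, w, Y, -, hA⟩ := Finset.mem_filter.1 hA
    exact (le_card_sub_rank_of_mul_fromRows_one_eq_zero _ Y hA.2).trans
      (card_sub_rank_submatrix_le_maxDeficiency A (hσ w))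
  · intro w Y _
    have key := card_filter_annihilator_and_mul_card (hσ w) (Matrix.fromRows 1 Y) (τ w)
      (fun v hv => by
        obtain ⟨i, hi⟩ := Function.ne_iff.1 hv
        refine ⟨Sum.inl i, ?_, by simpa [Matrix.fromRows_mulVec] using hi⟩
        rintro ⟨x, hx⟩
        exact Sum.inr_ne_inl (hσ w hx))
      q
    refine Nat.le_of_mul_le_mul_right ?_ hVpos
    calc (V.filter fun A => E w Y A).card * V.card
        ≤ (V.filter fun A => E w Y A).card * (2 * (V.filter (p w)).card) :=
          Nat.mul_le_mul_left _ (hp w)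
      _ = 2 * ((V.filter fun A => E w Y A).card * (V.filter (p w)).card) := by ring
      _ = 2 * ((V.filter fun A => E w Y A ∧ p w A).card * V.card) := congrArg (2 * ·) key.symm
      _ = _ := by ring
  · intro w w' hww Y hY Y' _
    obtain ⟨a, ha⟩ := Function.ne_iff.1 hww
    obtain ⟨q', hq'⟩ : ∃ q' : Matrix (Fin k ⊕ Fin t × Fin r) (Fin k ⊕ Fin t × Fin r) (ZMod 2) →
        Prop, ∀ R, q' R ↔ R * Matrix.fromRows (1 : Matrix (Fin k) (Fin k) (ZMod 2)) Y' = 0 :=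
      ⟨_, fun _ => Iff.rfl⟩
    have key := card_filter_annihilator_and_mul_card (hσ w) (Matrix.fromRows 1 Y) (σ w')
      (fun v hv => by
        obtain ⟨b, hb⟩ := (Finset.mem_filter.1 hY).2 a v hv
        exact ⟨Sum.inr (a, b), wordEmbedding_notMem_range e ha b,
          by simpa [Matrix.fromRows_mulVec] using hb⟩)
      q'
    have hE : ∀ A ∈ V, (E w' Y' A ↔ q' (A.submatrix (σ w') (σ w'))) := fun A hA =>
      ⟨fun h => (hq' _).2 h.2, fun h => ⟨mem_symZeroDiag.1 hA, (hq' _).1 h⟩⟩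
    rw [Finset.filter_congr hE,
      Finset.filter_congr fun A hA => and_congr_right' (a := E w Y A) (hE A hA)]
    exact key.le
  · intro w A _ hpA
    refine (Finset.card_le_card fun Y hY => ?_).trans (card_mul_eq_le _ ((hq _).1 hpA)
      (-(A.submatrix (σ w) (σ w)).toBlocks₂₁))
    obtain ⟨-, -, hAY⟩ := Finset.mem_filter.1 hY
    refine Finset.mem_filter.2 ⟨Finset.mem_univ _, ?_⟩
    exact toBlocks_mul_eq_neg_of_mul_fromRows_one_eq_zero _ Y hAY
  · have hE : ∀ w Y, V.card ≤ (V.filter fun A => E w Y A).card * 2 ^ ((k + t * r) * k) := by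
      intro w Y
      have h := card_symZeroDiagSubgroup_le (σ w) (Matrix.fromRows 1 Y)
      simp only [Fintype.card_sum, Fintype.card_prod, Fintype.card_fin] at h
      convert h using 2
      · ext A; simp [V, mem_symZeroDiag]
      · congr 1
        ext A
        simp only [V, E, Finset.mem_filter, mem_symZeroDiag, Finset.mem_univ, true_and]
        exact ⟨fun h => h.2, fun h => ⟨h.1, h⟩⟩
    refine Nat.le_of_mul_le_mul_right ?_
      (show 0 < 2 * 2 ^ ((k + t * r) * k) by positivity)
    calc 2 ^ (k * k) * V.card * (2 * 2 ^ ((k + t * r) * k))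
        ≤ 2 ^ t * (2 * G.card) * V.card := two_pow_mul_le_of_le hG ht _
      _ = 2 * ∑ w : Fin t → Bool, ∑ Y ∈ G, V.card := by
          rw [Finset.sum_const, Finset.sum_const, Finset.card_univ, Fintype.card_fun,
            Fintype.card_bool, Fintype.card_fin, smul_eq_mul, smul_eq_mul]
          ring
      _ ≤ 2 * ∑ w : Fin t → Bool, ∑ Y ∈ G,
            (V.filter fun A => E w Y A).card * 2 ^ ((k + t * r) * k) :=
          Nat.mul_le_mul_left _ (Finset.sum_le_sum fun w _ => Finset.sum_le_sum fun Y _ => hE w Y)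
      _ = _ := by simp only [← Finset.sum_mul]; ring

lemma mul_card_le_eight_mul_sum_maxDeficiency {n k : ℕ} (hk : 81 * k ^ 4 ≤ n) :
    k * (symZeroDiag n).card ≤ 8 * ∑ A ∈ symZeroDiag n, maxDeficiency A := by
  rcases Nat.eq_zero_or_pos k with rfl | hk0
  · simp
  let t := 2 * (k * k) + 1
  have hcard : Fintype.card (Fin k ⊕ (Fin t × Fin (k + t) × Bool)) ≤ Fintype.card (Fin n) := by
    simp only [Fintype.card_sum, Fintype.card_prod, Fintype.card_fin, Fintype.card_bool]
    refine le_trans ?_ hk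
    have h1 : k ≤ k ^ 2 := Nat.le_self_pow two_ne_zero k
    have h2 : 1 ≤ k ^ 2 := Nat.one_le_pow _ _ hk0
    have h3 : k ≤ k ^ 4 := Nat.le_self_pow four_ne_zero k
    have ht3 : t ≤ 3 * k ^ 2 := by simp only [t]; nlinarith
    calc k + t * ((k + t) * 2) ≤ k ^ 4 + (3 * k ^ 2) * ((k ^ 2 + 3 * k ^ 2) * 2) := by gcongr
      _ ≤ 81 * k ^ 4 := by ring_nf; omega
  obtain ⟨e⟩ := Function.Embedding.nonempty_of_card_le hcard
  refine card_mul_le_eight_mul_sum_maxDeficiency e ?_ le_rfl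
  have h : 2 * t ≤ 2 ^ t := by
    obtain ⟨s, hs⟩ : ∃ s, t = s + 1 := ⟨2 * (k * k), rfl⟩
    have := s.lt_two_pow_self
    rw [hs, pow_succ]
    omega
  rw [pow_add, mul_comm (2 ^ k)]
  exact Nat.mul_le_mul_right _ h

/-- there are `c > 0` and `N` such that for every perfect square `n ≥ N`,
the uniform average over the `n × n` symmetric zero-diagonal matrices `A` over `ZMod 2`
of the maximal rank deficiency `max_{S ⊆ Fin n} (S.card - rank A[S])` of principal
submatrices is at least `c * n^(1/4) / log n`. -/
theorem stmt_17 :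
    ∃ c : ℝ, 0 < c ∧ ∃ N : ℕ, ∀ n : ℕ, N ≤ n → (∃ k : ℕ, n = k ^ 2) →
      c * (n : ℝ) ^ ((1 : ℝ) / 4) / Real.log n ≤
        (∑ A ∈ symZeroDiag n,
            (((Finset.univ : Finset (Finset (Fin n))).sup
              (fun S => S.card - (principalSub A S).rank) : ℕ) : ℝ)) /
          ((symZeroDiag n).card : ℝ) := by
  refine ⟨1 / 48, by norm_num, 1296, fun n hn _ => ?_⟩
  set x : ℝ := (n : ℝ) ^ ((1 : ℝ) / 4) with hx
  have hnR : (1296 : ℝ) ≤ n := by exact_mod_cast hn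
  have hx0 : 0 ≤ x := by positivity
  have hx4 : x ^ 4 = n := by
    rw [hx, ← Real.rpow_natCast, ← Real.rpow_mul (Nat.cast_nonneg n)]
    norm_num
  have hx6 : 6 ≤ x := by
    refine le_of_pow_le_pow_left₀ four_ne_zero hx0 ?_
    rw [hx4]; linarith
  have hlog : 1 ≤ Real.log n := by
    rw [Real.le_log_iff_exp_le (by linarith)]
    linarith [Real.exp_one_lt_d9]
  let k := ⌊x / 3⌋₊
  have hkle : (k : ℝ) ≤ x / 3 := Nat.floor_le (by positivity)
  have hkge : x / 6 ≤ k := by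
    have := Nat.lt_floor_add_one (x / 3)
    simp only [k]
    linarith
  have hk : 81 * k ^ 4 ≤ n := by
    have h : (81 : ℝ) * (k : ℝ) ^ 4 ≤ n := by
      calc (81 : ℝ) * (k : ℝ) ^ 4 ≤ (81 : ℝ) * (x / 3) ^ 4 := by gcongr
        _ = (n : ℝ) := by rw [← hx4]; ring
    exact_mod_cast h
  have hmain : (k : ℝ) * (symZeroDiag n).card ≤
      8 * ∑ A ∈ symZeroDiag n, (maxDeficiency A : ℝ) := by
    exact_mod_cast mul_card_le_eight_mul_sum_maxDeficiency hk
  have hpos : (0 : ℝ) < (symZeroDiag n).card := by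
    exact_mod_cast Finset.card_pos.2 ⟨0, mem_symZeroDiag.2 (zero_mem _)⟩
  calc 1 / 48 * x / Real.log n ≤ 1 / 48 * x := div_le_self (by positivity) hlog
    _ ≤ k / 8 := by linarith
    _ ≤ (∑ A ∈ symZeroDiag n, (maxDeficiency A : ℝ)) / (symZeroDiag n).card := by
      rw [le_div_iff₀ hpos]; linarith
end
end

section
/- Let A be an m × m symmetric matrix over 𝔽₂ with zero diagonal and let U be its strictly upper triangular part (so U_{ij} = A_{ij} for i < j and U_{ij} = 0 otherwise). Then max over x ∈ 𝔽₂^m of | Σ_{z ∈ {0,1}^m} (−1)^{z^T U z + x^T z} |² = 2^{2m − rank(A)}, where the exponent z^T U z + x^T z is computed in 𝔽₂ and rank(A) is the rank of A over 𝔽₂ (which is even). -/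
open scoped BigOperators

noncomputable section

/-- The sign character of `ZMod 2`: `(-1)^b` is `1` if `b = 0` and `-1` if `b = 1`. -/
def signChar (b : ZMod 2) : ℤ := if b = 0 then 1 else -1

lemma signChar_add (a b : ZMod 2) : signChar (a + b) = signChar a * signChar b := by
  revert a b; decide

lemma signChar_zero : signChar 0 = 1 := rfl

lemma signChar_le_one (a : ZMod 2) : signChar a ≤ 1 := by
  revert a; decide

/-- A nontrivial linear functional on a finite `ZMod 2`-space has vanishing character sum. -/
lemma sum_signChar_linear {V : Type*} [AddCommGroup V] [Module (ZMod 2) V] [Fintype V]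
    (l : V →ₗ[ZMod 2] ZMod 2) [Decidable (l = 0)] :
    ∑ z, signChar (l z) = if l = 0 then (Fintype.card V : ℤ) else 0 := by
  split_ifs with h
  · simp [h, signChar_zero]
  · obtain ⟨v, hv⟩ : ∃ v, l v ≠ 0 := by
      by_contra! hl
      exact h (LinearMap.ext hl)
    have hneg : signChar (l v) = -1 := if_neg hv
    have := Equiv.sum_comp (Equiv.addRight v) fun z => signChar (l z)
    simp only [Equiv.coe_addRight, map_add, signChar_add, hneg, ← Finset.sum_mul] at this
    linarith

section UpperForm

variable {m : ℕ}

/-- The quadratic form `zᵀUz` where `U` is the strictly upper triangular part of `A`. -/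
def upperForm (A : Matrix (Fin m) (Fin m) (ZMod 2)) (z : Fin m → ZMod 2) : ZMod 2 :=
  ∑ i : Fin m, ∑ j : Fin m, if i < j then z i * A i j * z j else 0

lemma upperForm_add {A : Matrix (Fin m) (Fin m) (ZMod 2)}
    (hsym : A.IsSymm) (hdiag : ∀ i, A i i = 0) (z w : Fin m → ZMod 2) :
    upperForm A (z + w) = upperForm A z + upperForm A w + A.mulVec w ⬝ᵥ z := by
  have hpolar : A.mulVec w ⬝ᵥ z =
      (∑ i, ∑ j, if i < j then z i * A i j * w j else 0) +
        ∑ i, ∑ j, if i < j then w i * A i j * z j else 0 := by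
    rw [Finset.sum_comm (f := fun i j => if i < j then w i * A i j * z j else 0)]
    simp only [dotProduct, Matrix.mulVec, Finset.sum_mul, ← Finset.sum_add_distrib]
    refine Finset.sum_congr rfl fun i _ => Finset.sum_congr rfl fun j _ => ?_
    rcases lt_trichotomy i j with h | rfl | h
    · simp only [h, h.not_gt, if_true, if_false]; ring
    · simp [hdiag]
    · simp only [h, h.not_gt, if_true, if_false, hsym.apply i j]; ring
  rw [hpolar]
  simp only [upperForm, ← Finset.sum_add_distrib]
  refine Finset.sum_congr rfl fun i _ => Finset.sum_congr rfl fun j _ => ?_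
  split_ifs
  · simp only [Pi.add_apply]; ring
  · simp

/-- The squared exponential sum localizes to the kernel of the polar form. -/
lemma sq_sum_signChar_upperForm {A : Matrix (Fin m) (Fin m) (ZMod 2)}
    (hsym : A.IsSymm) (hdiag : ∀ i, A i i = 0) (x : Fin m → ZMod 2) :
    (∑ z, signChar (upperForm A z + x ⬝ᵥ z)) ^ 2 =
      2 ^ m * ∑ u with A.mulVec u = 0, signChar (upperForm A u + x ⬝ᵥ u) := by
  have hterm (z u : Fin m → ZMod 2) :
      signChar (upperForm A z + x ⬝ᵥ z) * signChar (upperForm A (u + z) + x ⬝ᵥ (u + z)) =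
        signChar (upperForm A u + x ⬝ᵥ u) * signChar (A.mulVec u ⬝ᵥ z) := by
    rw [← signChar_add, ← signChar_add, add_comm u z, upperForm_add hsym hdiag, dotProduct_add]
    congr 1
    linear_combination CharTwo.add_self_eq_zero (upperForm A z + x ⬝ᵥ z)
  have hchar (v : Fin m → ZMod 2) :
      ∑ z, signChar (v ⬝ᵥ z) = if v = 0 then (2 : ℤ) ^ m else 0 := by
    classical
    have := sum_signChar_linear (dotProductEquiv (ZMod 2) (Fin m) v)
    simpa [ZMod.card] using this
  calc (∑ z, signChar (upperForm A z + x ⬝ᵥ z)) ^ 2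
      = ∑ z, ∑ u, signChar (upperForm A z + x ⬝ᵥ z) *
          signChar (upperForm A (u + z) + x ⬝ᵥ (u + z)) := by
        rw [sq, Finset.sum_mul]
        refine Finset.sum_congr rfl fun z _ => ?_
        rw [← Finset.mul_sum]
        exact congrArg _ (Equiv.sum_comp (Equiv.addRight z)
          fun w => signChar (upperForm A w + x ⬝ᵥ w)).symm
    _ = ∑ u, signChar (upperForm A u + x ⬝ᵥ u) * ∑ z, signChar (A.mulVec u ⬝ᵥ z) := by
        simp only [hterm]
        rw [Finset.sum_comm]
        simp only [Finset.mul_sum]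
    _ = _ := by
        simp only [hchar, Finset.sum_filter, Finset.mul_sum]
        refine Finset.sum_congr rfl fun u _ => ?_
        split_ifs <;> ring

lemma card_mulVec_eq_zero (A : Matrix (Fin m) (Fin m) (ZMod 2)) :
    ({u | A.mulVec u = 0} : Finset (Fin m → ZMod 2)).card = 2 ^ (m - A.rank) := by
  have hfin := A.mulVecLin.finrank_range_add_finrank_ker
  have hcard := Module.natCard_eq_pow_finrank (K := ZMod 2) (V := LinearMap.ker A.mulVecLin)
  rw [Module.finrank_fin_fun] at hfin
  rw [Nat.card_zmod] at hcard
  have hexp : m - A.rank = Module.finrank (ZMod 2) (LinearMap.ker A.mulVecLin) := by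
    rw [Matrix.rank]
    omega
  rw [hexp, ← hcard, ← Fintype.card_subtype, ← Nat.card_eq_fintype_card]
  rfl

/-- On the kernel of the polar form, `upperForm A` agrees with a linear functional. -/
lemma exists_dotProduct_eq_upperForm {A : Matrix (Fin m) (Fin m) (ZMod 2)}
    (hsym : A.IsSymm) (hdiag : ∀ i, A i i = 0) :
    ∃ x : Fin m → ZMod 2, ∀ u, A.mulVec u = 0 → x ⬝ᵥ u = upperForm A u := by
  let l : LinearMap.ker A.mulVecLin →+ ZMod 2 :=
    AddMonoidHom.mk' (fun u => upperForm A u) fun u v => by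
      have hv : A.mulVec v = 0 := v.2
      simp [upperForm_add hsym hdiag, hv]
  obtain ⟨g, hg⟩ := (l.toZModLinearMap 2).exists_extend
  refine ⟨(dotProductEquiv (ZMod 2) (Fin m)).symm g, fun u hu => ?_⟩
  have h := LinearMap.congr_fun hg ⟨u, hu⟩
  rw [← dotProductEquiv_apply_apply, LinearEquiv.apply_symm_apply]
  exact h

end UpperForm

/-- for an `m × m` symmetric matrix `A` over `ZMod 2` with zero diagonal
and `U` its strictly upper triangular part, the maximum over `x ∈ (ZMod 2)^m` of
`|Σ_{z ∈ {0,1}^m} (−1)^{zᵀUz + xᵀz}|²` equals `2^(2m − rank A)`, the rank taken over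
`ZMod 2` and the exponent `zᵀUz + xᵀz` computed in `ZMod 2`. -/
theorem stmt_18 (m : ℕ) (A : Matrix (Fin m) (Fin m) (ZMod 2))
    (hsym : A.IsSymm) (hdiag : ∀ i, A i i = 0) :
    (Finset.univ : Finset (Fin m → ZMod 2)).sup' Finset.univ_nonempty
        (fun x => (∑ z : Fin m → ZMod 2,
          signChar ((∑ i : Fin m, ∑ j : Fin m, if i < j then z i * A i j * z j else 0) +
            ∑ i : Fin m, x i * z i)) ^ 2) =
      2 ^ (2 * m - A.rank) := by
  change Finset.univ.sup' _ (fun x => (∑ z, signChar (upperForm A z + x ⬝ᵥ z)) ^ 2) = _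
  have hrank : A.rank ≤ m := by simpa using A.rank_le_width
  have hvalue : (2 : ℤ) ^ (2 * m - A.rank) =
      2 ^ m * (({u | A.mulVec u = 0} : Finset (Fin m → ZMod 2)).card : ℤ) := by
    rw [card_mulVec_eq_zero, Nat.cast_pow, Nat.cast_ofNat, ← pow_add]
    congr 1
    omega
  simp only [sq_sum_signChar_upperForm hsym hdiag, hvalue]
  apply le_antisymm
  · refine Finset.sup'_le _ _ fun x _ => mul_le_mul_of_nonneg_left ?_ (by positivity)
    simpa using Finset.sum_le_card_nsmul _ _ 1 fun u _ => signChar_le_one (upperForm A u + x ⬝ᵥ u)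
  · obtain ⟨x, hx⟩ := exists_dotProduct_eq_upperForm hsym hdiag
    refine le_trans (le_of_eq ?_) (Finset.le_sup' _ (Finset.mem_univ x))
    rw [Finset.card_eq_sum_ones, Nat.cast_sum]
    refine congrArg _ (Finset.sum_congr rfl fun u hu => ?_)
    rw [hx u (Finset.mem_filter.1 hu).2, CharTwo.add_self_eq_zero, signChar_zero, Nat.cast_one]
end
end
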